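/- (Corollary 2, ZeroSARAH with no full gradient computations.) Suppose n ≥ 2 is a perfect square and f is bounded below with f* := inf_x f(x). Run ZeroSARAH with constant stepsize η_k = η := 1/((1+√8)L), minibatch sizes b_k = √n for all k ≥ 0, and parameters λ_0 = 1, λ_k = 1/(2√n) for k ≥ 1. Then for every K ≥ 1, (1/K) ∑_{k=0}^{K−1} E[‖∇f(x^k)‖²] ≤ (2(1+√8)L(f(x⁰) − f*) + 6 G_0)/K, where G_0 := (1/n)∑_{i=1}^n ‖∇f_i(x⁰)‖². Consequently, for every ε > 0, taking K = ⌈(2(1+√8)L(f(x⁰) − f*) + 6G_0)/ε²⌉ yields (1/K)∑_{k<K}E[‖∇f(x^k)‖²] ≤ ε² with total stochastic gradient computations √n·K ≤ √n(2(1+√8)L(f(x⁰)−f*) + 6G_0)/ε² + √n. Moreover, if each f_i is bounded below, then G_0 ≤ 2L(f(x⁰) − f̂*), where f̂* := (1/n)∑_{i=1}^n inf_x f_i(x). -/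

import Mathlib

noncomputable section

/-- The average function `f = (1/n) ∑ᵢ fᵢ`. -/
noncomputable def avgF {d n : ℕ} (f : Fin n → EuclideanSpace ℝ (Fin d) → ℝ) :
    EuclideanSpace ℝ (Fin d) → ℝ :=
  fun z => (n : ℝ)⁻¹ * ∑ i, f i z

/-- The ZeroSARAH random process.  Given a draw `ω : ℕ → Finset (Fin n)` of minibatches,
`zsState f η lam b x0 ω k = (xᵏ, xᵏ⁻¹, vᵏ⁻¹, y^{k−1})`, with
`x⁻¹ = x⁰`, `v⁻¹ = 0`, `y⁻¹ = 0`, and at each step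
`vᵏ = (1/bₖ)∑_{i∈Iₖ}(∇fᵢ(xᵏ) − ∇fᵢ(xᵏ⁻¹)) + (1−λₖ)vᵏ⁻¹
     + λₖ[(1/bₖ)∑_{i∈Iₖ}(∇fᵢ(xᵏ⁻¹) − yᵢᵏ⁻¹) + (1/n)∑ⱼ yⱼᵏ⁻¹]`,
`xᵏ⁺¹ = xᵏ − ηₖ vᵏ`, `yᵢᵏ = ∇fᵢ(xᵏ)` for `i ∈ Iₖ`, `yᵢᵏ = yᵢᵏ⁻¹` otherwise. -/
noncomputable def zsState {d n : ℕ} (f : Fin n → EuclideanSpace ℝ (Fin d) → ℝ)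
    (η lam : ℕ → ℝ) (b : ℕ → ℕ) (x0 : EuclideanSpace ℝ (Fin d))
    (ω : ℕ → Finset (Fin n)) :
    ℕ → EuclideanSpace ℝ (Fin d) × EuclideanSpace ℝ (Fin d) ×
      EuclideanSpace ℝ (Fin d) × (Fin n → EuclideanSpace ℝ (Fin d))
  | 0 => (x0, x0, 0, fun _ => 0)
  | (k + 1) =>
      let st := zsState f η lam b x0 ω k
      let v : EuclideanSpace ℝ (Fin d) :=
        (b k : ℝ)⁻¹ • ∑ i ∈ ω k, (gradient (f i) st.1 - gradient (f i) st.2.1)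
          + (1 - lam k) • st.2.2.1
          + lam k • ((b k : ℝ)⁻¹ • ∑ i ∈ ω k, (gradient (f i) st.2.1 - st.2.2.2 i)
              + (n : ℝ)⁻¹ • ∑ j, st.2.2.2 j)
      (st.1 - η k • v, st.1, v,
        fun i => if i ∈ ω k then gradient (f i) st.1 else st.2.2.2 i)

/-- Expectation over the first `k` independent uniformly random minibatches
`I₀, …, I_{k−1}` with `|Iⱼ| = bⱼ`, of a functional of the whole draw. -/
noncomputable def zsExpK {n : ℕ} (b : ℕ → ℕ) (k : ℕ)
    (g : (ℕ → Finset (Fin n)) → ℝ) : ℝ :=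
  (∑ τ ∈ Finset.univ.filter
      (fun τ : Fin k → Finset (Fin n) => ∀ j : Fin k, (τ j).card = b j.val),
    g (fun j => if h : j < k then τ ⟨j, h⟩ else ∅)) /
  ((Finset.univ.filter
      (fun τ : Fin k → Finset (Fin n) => ∀ j : Fin k, (τ j).card = b j.val)).card : ℝ)

/-- Average over uniformly random subsets of size `r`. -/
def zsAvg {n : ℕ} (r : ℕ) (g : Finset (Fin n) → ℝ) : ℝ :=
  (∑ I ∈ Finset.powersetCard r (Finset.univ : Finset (Fin n)), g I) /
    ((Finset.powersetCard r (Finset.univ : Finset (Fin n))).card : ℝ)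

theorem zs_count_pos {n r : ℕ} (hrn : r ≤ n) :
    (0 : ℝ) < ((Finset.powersetCard r (Finset.univ : Finset (Fin n))).card : ℝ) := by
  rw [Finset.card_powersetCard]
  simp only [Finset.card_univ, Fintype.card_fin]
  exact_mod_cast Nat.choose_pos hrn

theorem zsAvg_const {n r : ℕ} (hrn : r ≤ n) (c : ℝ) :
    zsAvg (n := n) r (fun _ => c) = c := by
  have := zs_count_pos hrn
  unfold zsAvg
  rw [Finset.sum_const, nsmul_eq_mul]
  field_simp

theorem zsAvg_add {n r : ℕ} (g h : Finset (Fin n) → ℝ) :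
    zsAvg r (fun I => g I + h I) = zsAvg r g + zsAvg r h := by
  unfold zsAvg
  rw [Finset.sum_add_distrib, add_div]

theorem zsAvg_mul {n r : ℕ} (c : ℝ) (g : Finset (Fin n) → ℝ) :
    zsAvg r (fun I => c * g I) = c * zsAvg r g := by
  unfold zsAvg
  rw [← Finset.mul_sum, mul_div_assoc]

theorem zsAvg_mono {n r : ℕ} (g h : Finset (Fin n) → ℝ) (hgh : ∀ I, I.card = r → g I ≤ h I) :
    zsAvg r g ≤ zsAvg r h := by
  unfold zsAvg
  gcongr with I hI
  exact hgh I (Finset.mem_powersetCard.1 hI).2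

/-- Number of `r`-subsets containing `i`. -/
theorem zs_count_single {n r : ℕ} (hr : 1 ≤ r) (i : Fin n) :
    ((Finset.powersetCard r (Finset.univ : Finset (Fin n))).filter (fun I => i ∈ I)).card
      = (n - 1).choose (r - 1) := by
  have h := Finset.card_filter_powersetCard_subset ({i} : Finset (Fin n)) Finset.univ r
    (Finset.subset_univ _) (by simpa using hr)
  simpa using h

/-- Number of `r`-subsets containing `i` and `j`, `i ≠ j`. -/
theorem zs_count_pair {n r : ℕ} (hr : 2 ≤ r) (i j : Fin n) (hij : i ≠ j) :
    ((Finset.powersetCard r (Finset.univ : Finset (Fin n))).filter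
      (fun I => i ∈ I ∧ j ∈ I)).card = (n - 2).choose (r - 2) := by
  have hc : ({i, j} : Finset (Fin n)).card = 2 := Finset.card_pair hij
  have h := Finset.card_filter_powersetCard_subset ({i, j} : Finset (Fin n)) Finset.univ r
    (Finset.subset_univ _) (by omega)
  rw [hc] at h
  simpa [Finset.insert_subset_iff] using h

theorem zs_sum_linear {n r : ℕ} (hr : 1 ≤ r) (w : Fin n → ℝ) :
    ∑ I ∈ Finset.powersetCard r (Finset.univ : Finset (Fin n)), ∑ i ∈ I, w i
      = ((n - 1).choose (r - 1) : ℝ) * ∑ i, w i := by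
  have h1 : ∀ I : Finset (Fin n), ∑ i ∈ I, w i = ∑ i, if i ∈ I then w i else 0 := by
    intro I
    simp
  rw [Finset.sum_congr rfl (fun I _ => h1 I), Finset.sum_comm, Finset.mul_sum]
  refine Finset.sum_congr rfl fun i _ => ?_
  rw [← Finset.sum_filter, Finset.sum_const, zs_count_single hr i, nsmul_eq_mul]

theorem zs_count_rel {n r : ℕ} (hr : 1 ≤ r) :
    ((n - 1).choose (r - 1) : ℝ) * n
      = r * ((Finset.powersetCard r (Finset.univ : Finset (Fin n))).card : ℝ) := by
  have h := zs_sum_linear (n := n) hr (fun _ => (1 : ℝ))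
  simp only [Finset.sum_const, nsmul_eq_mul, mul_one, Finset.card_univ, Fintype.card_fin] at h
  rw [← h]
  rw [Finset.sum_congr rfl (g := fun _ => (r : ℝ))
    (fun I hI => by rw [(Finset.mem_powersetCard.1 hI).2])]
  rw [Finset.sum_const, nsmul_eq_mul, mul_comm]

theorem zsAvg_linear {n r : ℕ} (hr : 1 ≤ r) (hrn : r ≤ n) (w : Fin n → ℝ) :
    zsAvg r (fun I => ∑ i ∈ I, w i) = (r : ℝ) * ((n : ℝ)⁻¹ * ∑ i, w i) := by
  have h0 := zs_count_pos hrn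
  have h1 := zs_count_rel (n := n) hr
  have hn : (0 : ℝ) < n := by exact_mod_cast (by omega : 0 < n)
  unfold zsAvg
  rw [zs_sum_linear hr, div_eq_iff h0.ne']
  field_simp
  linear_combination (∑ i, w i) * h1

section
variable {V : Type*} [NormedAddCommGroup V] [InnerProductSpace ℝ V]

theorem zs_second_moment {n r : ℕ} (hr : 2 ≤ r) (c : Fin n → V) (hc : ∑ i, c i = 0) :
    ∑ I ∈ Finset.powersetCard r (Finset.univ : Finset (Fin n)), ‖∑ i ∈ I, c i‖ ^ 2
      ≤ ((n - 1).choose (r - 1) : ℝ) * ∑ i, ‖c i‖ ^ 2 := by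
  have h1 : ∀ I : Finset (Fin n), ‖∑ i ∈ I, c i‖ ^ 2
      = ∑ i, ∑ j, if i ∈ I ∧ j ∈ I then inner ℝ (c i) (c j) else 0 := by
    intro I
    rw [← real_inner_self_eq_norm_sq, sum_inner]
    simp_rw [inner_sum]
    simp_rw [ite_and]
    simp
  simp_rw [h1]
  rw [Finset.sum_comm]
  have h2 : ∀ i : Fin n, (∑ I ∈ Finset.powersetCard r (Finset.univ : Finset (Fin n)),
      ∑ j, if i ∈ I ∧ j ∈ I then inner ℝ (c i) (c j) else 0)
      = (((n - 1).choose (r - 1) : ℝ) - ((n - 2).choose (r - 2) : ℝ)) * ‖c i‖ ^ 2 := by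
    intro i
    rw [Finset.sum_comm]
    have h3 : ∀ j : Fin n, (∑ I ∈ Finset.powersetCard r (Finset.univ : Finset (Fin n)),
        if i ∈ I ∧ j ∈ I then inner ℝ (c i) (c j) else 0)
        = ((n - 2).choose (r - 2) : ℝ) * inner ℝ (c i) (c j) +
          if i = j then (((n - 1).choose (r - 1) : ℝ) - ((n - 2).choose (r - 2) : ℝ))
            * ‖c i‖ ^ 2 else 0 := by
      intro j
      rw [← Finset.sum_filter, Finset.sum_const, nsmul_eq_mul]
      by_cases hij : i = j
      · subst hij
        simp only [and_self, if_true]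
        rw [zs_count_single (by omega) i, real_inner_self_eq_norm_sq]
        ring
      · rw [zs_count_pair hr i j hij, if_neg hij, add_zero]
    simp_rw [h3]
    rw [Finset.sum_add_distrib, ← Finset.mul_sum, ← inner_sum, hc]
    simp
  simp_rw [h2]
  rw [← Finset.mul_sum]
  gcongr
  have : (0 : ℝ) ≤ ((n - 2).choose (r - 2) : ℝ) := by positivity
  linarith

theorem zsAvg_second {n r : ℕ} (hr : 2 ≤ r) (hrn : r ≤ n) (c : Fin n → V)
    (hc : ∑ i, c i = 0) :
    zsAvg r (fun I => ‖∑ i ∈ I, c i‖ ^ 2) ≤ (r : ℝ) * ((n : ℝ)⁻¹ * ∑ i, ‖c i‖ ^ 2) := by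
  have h0 := zs_count_pos hrn
  rw [← zsAvg_linear (by omega) hrn]
  unfold zsAvg
  rw [zs_sum_linear (by omega)]
  gcongr
  exact zs_second_moment hr c hc

theorem zsAvg_noise {n r : ℕ} (hr : 2 ≤ r) (hrn : r ≤ n) (A : V) (c : Fin n → V)
    (hc : ∑ i, c i = 0) :
    zsAvg r (fun I => ‖A + (r : ℝ)⁻¹ • ∑ i ∈ I, c i‖ ^ 2)
      ≤ ‖A‖ ^ 2 + (r : ℝ)⁻¹ * ((n : ℝ)⁻¹ * ∑ i, ‖c i‖ ^ 2) := by
  have hr0 : (0 : ℝ) < r := by exact_mod_cast (by omega : 0 < r)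
  have h1 : ∀ I : Finset (Fin n), ‖A + (r : ℝ)⁻¹ • ∑ i ∈ I, c i‖ ^ 2
      = (‖A‖ ^ 2 + (2 * (r : ℝ)⁻¹) * ∑ i ∈ I, inner ℝ A (c i))
        + ((r : ℝ)⁻¹ ^ 2) * ‖∑ i ∈ I, c i‖ ^ 2 := by
    intro I
    rw [norm_add_sq_real, inner_smul_right, inner_sum, norm_smul, mul_pow, Real.norm_eq_abs,
      sq_abs]
    ring
  simp_rw [h1]
  rw [zsAvg_add, zsAvg_add, zsAvg_const hrn, zsAvg_mul, zsAvg_mul, zsAvg_linear (by omega) hrn,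
    ← inner_sum, hc, inner_zero_right]
  have h2 := zsAvg_second hr hrn c hc
  have h3 : (r : ℝ)⁻¹ ^ 2 * zsAvg r (fun I => ‖∑ i ∈ I, c i‖ ^ 2)
      ≤ (r : ℝ)⁻¹ ^ 2 * ((r : ℝ) * ((n : ℝ)⁻¹ * ∑ i, ‖c i‖ ^ 2)) := by gcongr
  have h4 : (r : ℝ)⁻¹ ^ 2 * ((r : ℝ) * ((n : ℝ)⁻¹ * ∑ i, ‖c i‖ ^ 2))
      = (r : ℝ)⁻¹ * ((n : ℝ)⁻¹ * ∑ i, ‖c i‖ ^ 2) := by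
    field_simp
  linarith

/-- Centering decreases the second moment. -/
theorem zs_center {n : ℕ} (hn : 1 ≤ n) (a : Fin n → V) :
    ∑ i, ‖a i - (n : ℝ)⁻¹ • ∑ j, a j‖ ^ 2 ≤ ∑ i, ‖a i‖ ^ 2 := by
  have hn0 : (0 : ℝ) < n := by exact_mod_cast hn
  set m := (n : ℝ)⁻¹ • ∑ j, a j with hm
  have hs : ∑ j, a j = (n : ℝ) • m := by
    rw [hm, smul_smul, mul_inv_cancel₀ hn0.ne', one_smul]
  simp_rw [norm_sub_sq_real]
  rw [Finset.sum_add_distrib, Finset.sum_sub_distrib, ← Finset.mul_sum, ← sum_inner, hs,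
    inner_smul_left, real_inner_self_eq_norm_sq]
  simp
  nlinarith [sq_nonneg ‖m‖]

theorem zs_center_sum {n : ℕ} (hn : 1 ≤ n) (a : Fin n → V) :
    ∑ i, (a i - (n : ℝ)⁻¹ • ∑ j, a j) = 0 := by
  have hn0 : (0 : ℝ) < n := by exact_mod_cast hn
  rw [Finset.sum_sub_distrib, Finset.sum_const, Finset.card_univ, Fintype.card_fin,
    ← Nat.cast_smul_eq_nsmul ℝ, smul_smul, mul_inv_cancel₀ hn0.ne', one_smul, sub_self]

theorem zs_descent [CompleteSpace V] (g : V → ℝ) (hg : Differentiable ℝ g) (L : ℝ)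
    (hL : ∀ x y, ‖gradient g x - gradient g y‖ ≤ L * ‖x - y‖) (x y : V) :
    g y ≤ g x + inner ℝ (gradient g x) (y - x) + L / 2 * ‖y - x‖ ^ 2 := by
  set u := y - x with hu
  have hd : ∀ t : ℝ, HasDerivAt (fun t : ℝ => g (x + t • u) - t * inner ℝ (gradient g x) u
      - L / 2 * t ^ 2 * ‖u‖ ^ 2)
      (inner ℝ (gradient g (x + t • u)) u - inner ℝ (gradient g x) u - L * t * ‖u‖ ^ 2) t := by
    intro t
    have h1 : HasDerivAt (fun t : ℝ => x + t • u) u t := by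
      simpa using ((hasDerivAt_id t).smul_const u).const_add x
    have h2 := (hg (x + t • u)).hasGradientAt.hasFDerivAt.comp_hasDerivAt t h1
    have h3 := h2.sub ((hasDerivAt_id t).mul_const (inner ℝ (gradient g x) u))
    have h4 := h3.sub ((((hasDerivAt_id t).pow 2).const_mul (L / 2)).mul_const (‖u‖ ^ 2))
    refine h4.congr_deriv ?_
    rw [InnerProductSpace.toDual_apply_apply]
    simp only [id, pow_one, Nat.add_one_sub_one, Nat.cast_ofNat]
    ring
  have hanti : AntitoneOn (fun t : ℝ => g (x + t • u) - t * inner ℝ (gradient g x) u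
      - L / 2 * t ^ 2 * ‖u‖ ^ 2) (Set.Icc 0 1) := by
    apply antitoneOn_of_deriv_nonpos (convex_Icc 0 1)
    · exact fun t _ => (hd t).continuousAt.continuousWithinAt
    · exact fun t _ => (hd t).differentiableAt.differentiableWithinAt
    · intro t ht
      rw [interior_Icc] at ht
      rw [(hd t).deriv, ← inner_sub_left]
      have h1 := real_inner_le_norm (gradient g (x + t • u) - gradient g x) u
      have h2 := hL (x + t • u) x
      rw [add_sub_cancel_left, norm_smul, Real.norm_eq_abs, abs_of_pos ht.1] at h2
      nlinarith [mul_le_mul_of_nonneg_right h2 (norm_nonneg u)]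
  have := hanti (Set.left_mem_Icc.2 zero_le_one) (Set.right_mem_Icc.2 zero_le_one) zero_le_one
  have hone : x + (1 : ℝ) • u = y := by rw [hu, one_smul, add_sub_cancel]
  have hzero : x + (0 : ℝ) • u = x := by rw [zero_smul, add_zero]
  simp only [hone, hzero] at this
  linarith

theorem zs_grad_bound [CompleteSpace V] (g : V → ℝ) (hg : Differentiable ℝ g) (L : ℝ)
    (hL0 : 0 < L)
    (hL : ∀ x y, ‖gradient g x - gradient g y‖ ≤ L * ‖x - y‖) (x : V) (m : ℝ)
    (hm : ∀ y, m ≤ g y) : ‖gradient g x‖ ^ 2 ≤ 2 * L * (g x - m) := by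
  have h := zs_descent g hg L hL x (x - L⁻¹ • gradient g x)
  have h2 := hm (x - L⁻¹ • gradient g x)
  rw [sub_sub_cancel_left, inner_neg_right, inner_smul_right, real_inner_self_eq_norm_sq,
    norm_neg, norm_smul, mul_pow, Real.norm_eq_abs, sq_abs] at h
  have h3 : L⁻¹ * ‖gradient g x‖ ^ 2 - L / 2 * (L⁻¹ ^ 2 * ‖gradient g x‖ ^ 2)
      = ‖gradient g x‖ ^ 2 / (2 * L) := by
    field_simp; ring
  have h4 : ‖gradient g x‖ ^ 2 / (2 * L) ≤ g x - m := by linarith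
  rw [div_le_iff₀ (by positivity)] at h4
  linarith

end

section
variable {V : Type*} [NormedAddCommGroup V] [InnerProductSpace ℝ V]

theorem zs_sq_add_le (a b : V) : ‖a + b‖ ^ 2 ≤ 2 * ‖a‖ ^ 2 + 2 * ‖b‖ ^ 2 := by
  have := parallelogram_law_with_norm ℝ a b
  nlinarith [sq_nonneg ‖a - b‖]

theorem zs_young (a b : V) (t : ℝ) (ht : 0 < t) :
    ‖a + b‖ ^ 2 ≤ (1 + 1 / t) * ‖a‖ ^ 2 + (1 + t) * ‖b‖ ^ 2 := by
  have h1 : ‖a + b‖ ^ 2 ≤ (‖a‖ + ‖b‖) ^ 2 := by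
    gcongr
    exact norm_add_le a b
  have h2 : (1 + 1 / t) * ‖a‖ ^ 2 + (1 + t) * ‖b‖ ^ 2 - (‖a‖ + ‖b‖) ^ 2
      = (‖a‖ - t * ‖b‖) ^ 2 / t := by
    field_simp
    ring
  have h3 : 0 ≤ (‖a‖ - t * ‖b‖) ^ 2 / t := by positivity
  linarith

/-- One-step variance recursion, abstract form. -/
theorem zs_V_step {n r : ℕ} (hr : 2 ≤ r) (hrn : r ≤ n) (g p y : Fin n → V) (v : V)
    (lam q : ℝ) (hq : ∀ i, ‖g i - p i‖ ^ 2 ≤ q) :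
    zsAvg r (fun I => ‖((r : ℝ)⁻¹ • ∑ i ∈ I, (g i - p i) + (1 - lam) • v
        + lam • ((r : ℝ)⁻¹ • ∑ i ∈ I, (p i - y i) + (n : ℝ)⁻¹ • ∑ j, y j))
        - (n : ℝ)⁻¹ • ∑ i, g i‖ ^ 2)
      ≤ (1 - lam) ^ 2 * ‖v - (n : ℝ)⁻¹ • ∑ i, p i‖ ^ 2
        + (r : ℝ)⁻¹ * (2 * q + 2 * lam ^ 2 * ((n : ℝ)⁻¹ * ∑ i, ‖p i - y i‖ ^ 2)) := by
  have hr0 : (0 : ℝ) < r := by exact_mod_cast (by omega : 0 < r)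
  have hn0 : (0 : ℝ) < n := by exact_mod_cast (by omega : 0 < n)
  set a : Fin n → V := fun i => (g i - p i) + lam • (p i - y i) with ha
  set A : V := (1 - lam) • (v - (n : ℝ)⁻¹ • ∑ i, p i) with hA
  have h1 : zsAvg r (fun I => ‖((r : ℝ)⁻¹ • ∑ i ∈ I, (g i - p i) + (1 - lam) • v
        + lam • ((r : ℝ)⁻¹ • ∑ i ∈ I, (p i - y i) + (n : ℝ)⁻¹ • ∑ j, y j))
        - (n : ℝ)⁻¹ • ∑ i, g i‖ ^ 2)
      ≤ zsAvg r (fun I => ‖A + (r : ℝ)⁻¹ • ∑ i ∈ I, (a i - (n : ℝ)⁻¹ • ∑ j, a j)‖ ^ 2) := by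
    refine zsAvg_mono _ _ fun I hI => le_of_eq ?_
    congr 2
    have h2 : ∑ i ∈ I, (a i - (n : ℝ)⁻¹ • ∑ j, a j)
        = ∑ i ∈ I, a i - (r : ℝ) • ((n : ℝ)⁻¹ • ∑ j, a j) := by
      rw [Finset.sum_sub_distrib, Finset.sum_const, hI, Nat.cast_smul_eq_nsmul]
    rw [h2, smul_sub, smul_smul, inv_mul_cancel₀ hr0.ne', one_smul]
    simp only [ha, hA, Finset.sum_add_distrib, Finset.sum_sub_distrib, ← Finset.smul_sum]
    module
  have h3 := zsAvg_noise hr hrn A _ (zs_center_sum (by omega) a)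
  have h4 := zs_center (by omega) a
  have h5 : ∑ i, ‖a i‖ ^ 2 ≤ ∑ i : Fin n, (2 * q + 2 * lam ^ 2 * ‖p i - y i‖ ^ 2) := by
    refine Finset.sum_le_sum fun i _ => ?_
    have := zs_sq_add_le (g i - p i) (lam • (p i - y i))
    rw [norm_smul, mul_pow, Real.norm_eq_abs, sq_abs] at this
    have := hq i
    simp only [ha]
    linarith
  rw [Finset.sum_add_distrib, Finset.sum_const, ← Finset.mul_sum, Finset.card_univ,
    Fintype.card_fin, nsmul_eq_mul] at h5
  have h6 : ‖A‖ ^ 2 = (1 - lam) ^ 2 * ‖v - (n : ℝ)⁻¹ • ∑ i, p i‖ ^ 2 := by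
    rw [hA, norm_smul, mul_pow, Real.norm_eq_abs, sq_abs]
  have h7 : (r : ℝ)⁻¹ * ((n : ℝ)⁻¹ * ∑ i, ‖a i - (n : ℝ)⁻¹ • ∑ j, a j‖ ^ 2)
      ≤ (r : ℝ)⁻¹ * ((n : ℝ)⁻¹ * (n * (2 * q) + 2 * lam ^ 2 * ∑ i, ‖p i - y i‖ ^ 2)) := by
    gcongr
    exact h4.trans h5
  have h8 : (r : ℝ)⁻¹ * ((n : ℝ)⁻¹ * (n * (2 * q) + 2 * lam ^ 2 * ∑ i, ‖p i - y i‖ ^ 2))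
      = (r : ℝ)⁻¹ * (2 * q + 2 * lam ^ 2 * ((n : ℝ)⁻¹ * ∑ i, ‖p i - y i‖ ^ 2)) := by
    field_simp
  linarith

/-- One-step recursion of the table error, abstract form. -/
theorem zs_H_step {n r : ℕ} (hr : 2 ≤ r) (hn : n = r ^ 2) (g p y : Fin n → V)
    (q : ℝ) (hq : ∀ i, ‖g i - p i‖ ^ 2 ≤ q) (hq0 : 0 ≤ q) :
    zsAvg r (fun I => (n : ℝ)⁻¹ * ∑ i, ‖g i - (if i ∈ I then g i else y i)‖ ^ 2)
      ≤ (1 - 1 / (2 * r)) * ((n : ℝ)⁻¹ * ∑ i, ‖p i - y i‖ ^ 2) + 2 * r * q := by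
  have hr0 : (0 : ℝ) < r := by exact_mod_cast (by omega : 0 < r)
  have hr1 : (1 : ℝ) ≤ r := by exact_mod_cast (by omega : 1 ≤ r)
  have hrn : r ≤ n := by nlinarith
  have hn0 : (0 : ℝ) < n := by exact_mod_cast (by omega : 0 < n)
  have hnr : (n : ℝ) = r ^ 2 := by exact_mod_cast hn
  have h1 : ∀ I : Finset (Fin n),
      (n : ℝ)⁻¹ * ∑ i, ‖g i - (if i ∈ I then g i else y i)‖ ^ 2
      = (n : ℝ)⁻¹ * ∑ i, ‖g i - y i‖ ^ 2 + (-(n : ℝ)⁻¹) * ∑ i ∈ I, ‖g i - y i‖ ^ 2 := by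
    intro I
    have h2 : ∑ i ∈ I, ‖g i - y i‖ ^ 2 = ∑ i, if i ∈ I then ‖g i - y i‖ ^ 2 else 0 := by
      simp
    rw [h2, neg_mul, ← sub_eq_add_neg, ← mul_sub, ← Finset.sum_sub_distrib]
    congr 1
    refine Finset.sum_congr rfl fun i _ => ?_
    split_ifs <;> simp
  simp_rw [h1]
  rw [zsAvg_add, zsAvg_const hrn, zsAvg_mul, zsAvg_linear (by omega) hrn]
  have h3 : ∑ i, ‖g i - y i‖ ^ 2
      ≤ ∑ i : Fin n, ((1 + 1 / (2 * (r : ℝ))) * ‖p i - y i‖ ^ 2 + (1 + 2 * (r : ℝ)) * q) := by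
    refine Finset.sum_le_sum fun i _ => ?_
    have h := zs_young (p i - y i) (g i - p i) (2 * (r : ℝ)) (by positivity)
    have e : p i - y i + (g i - p i) = g i - y i := by abel
    rw [e] at h
    have h' : (1 + 2 * (r : ℝ)) * ‖g i - p i‖ ^ 2 ≤ (1 + 2 * (r : ℝ)) * q := by
      gcongr
      exact hq i
    linarith
  rw [Finset.sum_add_distrib, Finset.sum_const, ← Finset.mul_sum, Finset.card_univ,
    Fintype.card_fin, nsmul_eq_mul] at h3
  set S := ∑ i, ‖g i - y i‖ ^ 2
  set T := ∑ i, ‖p i - y i‖ ^ 2 with hT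
  have hT0 : 0 ≤ T := by positivity
  have h4 : (n : ℝ)⁻¹ * S + -(n : ℝ)⁻¹ * (r * ((n : ℝ)⁻¹ * S))
      = (1 - 1 / r) * ((n : ℝ)⁻¹ * S) := by
    rw [hnr]
    field_simp
    ring
  rw [h4]
  have h5 : (n : ℝ)⁻¹ * S ≤ (1 + 1 / (2 * (r : ℝ))) * ((n : ℝ)⁻¹ * T) + (1 + 2 * r) * q := by
    calc (n : ℝ)⁻¹ * S ≤ (n : ℝ)⁻¹ * ((1 + 1 / (2 * (r : ℝ))) * T + n * ((1 + 2 * r) * q)) := by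
          gcongr
      _ = _ := by field_simp
  have h6 : (0 : ℝ) ≤ 1 - 1 / r := by
    rw [sub_nonneg, div_le_one hr0]
    exact hr1
  have h7 := mul_le_mul_of_nonneg_left h5 h6
  refine h7.trans ?_
  set U := (n : ℝ)⁻¹ * T with hU
  have hU0 : 0 ≤ U := by positivity
  have h8 : (1 - 1 / (2 * (r : ℝ))) * U + 2 * r * q
      - (1 - 1 / (r : ℝ)) * ((1 + 1 / (2 * (r : ℝ))) * U + (1 + 2 * r) * q)
      = U / (2 * r ^ 2) + (1 + 1 / r) * q := by
    field_simp
    ring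
  have h9 : 0 ≤ U / (2 * (r : ℝ) ^ 2) + (1 + 1 / r) * q := by positivity
  linarith

end

theorem zs_pi_sum {n : ℕ} (b : ℕ → ℕ) (k : ℕ) (G : (Fin (k + 1) → Finset (Fin n)) → ℝ) :
    ∑ τ ∈ Finset.univ.filter
      (fun τ : Fin (k + 1) → Finset (Fin n) => ∀ j : Fin (k + 1), (τ j).card = b j.val), G τ
    = ∑ τ ∈ Finset.univ.filter
      (fun τ : Fin k → Finset (Fin n) => ∀ j : Fin k, (τ j).card = b j.val),
      ∑ I ∈ Finset.powersetCard (b k) (Finset.univ : Finset (Fin n)),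
        G (Fin.snoc (α := fun _ => Finset (Fin n)) τ I) := by
  rw [← Finset.sum_product']
  symm
  refine Finset.sum_bij'
    (fun p _ => Fin.snoc (α := fun _ => Finset (Fin n)) p.1 p.2)
    (fun τ _ => (Fin.init (α := fun _ => Finset (Fin n)) τ, τ (Fin.last k))) ?_ ?_ ?_ ?_ ?_
  · intro p hp
    simp only [Finset.mem_product, Finset.mem_filter, Finset.mem_univ, true_and,
      Finset.mem_powersetCard] at hp ⊢
    intro j
    refine Fin.lastCases ?_ (fun j => ?_) j
    · simpa using hp.2
    · simpa using hp.1 j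
  · intro τ hτ
    simp only [Finset.mem_product, Finset.mem_filter, Finset.mem_univ, true_and,
      Finset.mem_powersetCard] at hτ ⊢
    exact ⟨fun j => hτ j.castSucc, Finset.subset_univ _, hτ (Fin.last k)⟩
  · intro p _
    simp
  · intro τ _
    simp
  · intro p _
    rfl

theorem zs_extend {n k : ℕ} (τ : Fin k → Finset (Fin n)) (I : Finset (Fin n)) :
    (fun j => if h : j < k + 1 then
      (Fin.snoc (α := fun _ => Finset (Fin n)) τ I : Fin (k + 1) → Finset (Fin n)) ⟨j, h⟩ else ∅)
    = Function.update (fun j => if h : j < k then τ ⟨j, h⟩ else ∅) k I := by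
  funext j
  by_cases hj : j = k
  · subst hj
    simp [Fin.snoc]
  · rw [Function.update_of_ne hj]
    by_cases h : j < k
    · have h' : j < k + 1 := by omega
      simp [h, h', Fin.snoc]
    · have h' : ¬ j < k + 1 := by omega
      simp [h, h']

theorem zsExpK_succ {n : ℕ} (b : ℕ → ℕ) (k : ℕ) (g : (ℕ → Finset (Fin n)) → ℝ) :
    zsExpK b (k + 1) g
      = zsExpK b k (fun ω => zsAvg (b k) (fun I => g (Function.update ω k I))) := by
  have hcard := zs_pi_sum (n := n) b k (fun _ => 1)
  simp only [Finset.sum_const, nsmul_eq_mul, mul_one] at hcard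
  unfold zsExpK zsAvg
  rw [hcard, zs_pi_sum, ← Finset.sum_div, div_div]
  simp_rw [zs_extend]
  congr 1
  ring

theorem zsExpK_mono {n : ℕ} (b : ℕ → ℕ) (k : ℕ) (g h : (ℕ → Finset (Fin n)) → ℝ)
    (hgh : ∀ ω, g ω ≤ h ω) : zsExpK b k g ≤ zsExpK b k h := by
  unfold zsExpK
  gcongr
  exact hgh _

theorem zsExpK_sub_mul {n : ℕ} (b : ℕ → ℕ) (k : ℕ) (c : ℝ) (g h : (ℕ → Finset (Fin n)) → ℝ) :
    zsExpK b k (fun ω => g ω - c * h ω) = zsExpK b k g - c * zsExpK b k h := by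
  unfold zsExpK
  rw [Finset.sum_sub_distrib, ← Finset.mul_sum]
  ring

theorem zsExpK_zero {n : ℕ} (b : ℕ → ℕ) (g : (ℕ → Finset (Fin n)) → ℝ) :
    zsExpK b 0 g = g (fun _ => ∅) := by
  unfold zsExpK
  simp

theorem zsExpK_const {n : ℕ} (b : ℕ → ℕ) (hb : ∀ k, b k ≤ n) (k : ℕ) (c : ℝ) :
    zsExpK (n := n) b k (fun _ => c) = c := by
  induction k with
  | zero => rw [zsExpK_zero]
  | succ k ih =>
    rw [zsExpK_succ]
    simp_rw [zsAvg_const (hb k)]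
    exact ih

/-- State space of the process. -/
abbrev ZSt (d n : ℕ) : Type :=
  EuclideanSpace ℝ (Fin d) × EuclideanSpace ℝ (Fin d) ×
      EuclideanSpace ℝ (Fin d) × (Fin n → EuclideanSpace ℝ (Fin d))

/-- The new estimator. -/
def zsV {d n : ℕ} (f : Fin n → EuclideanSpace ℝ (Fin d) → ℝ) (lam : ℝ) (b : ℕ)
    (st : ZSt d n) (I : Finset (Fin n)) : EuclideanSpace ℝ (Fin d) :=
  (b : ℝ)⁻¹ • ∑ i ∈ I, (gradient (f i) st.1 - gradient (f i) st.2.1)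
          + (1 - lam) • st.2.2.1
          + lam • ((b : ℝ)⁻¹ • ∑ i ∈ I, (gradient (f i) st.2.1 - st.2.2.2 i)
              + (n : ℝ)⁻¹ • ∑ j, st.2.2.2 j)

/-- One step of the process. -/
def zsStep {d n : ℕ} (f : Fin n → EuclideanSpace ℝ (Fin d) → ℝ) (η lam : ℝ) (b : ℕ)
    (st : ZSt d n) (I : Finset (Fin n)) : ZSt d n :=
  (st.1 - η • zsV f lam b st I, st.1, zsV f lam b st I,
    fun i => if i ∈ I then gradient (f i) st.1 else st.2.2.2 i)

theorem zsState_succ {d n : ℕ} (f : Fin n → EuclideanSpace ℝ (Fin d) → ℝ)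
    (η lam : ℕ → ℝ) (b : ℕ → ℕ) (x0 : EuclideanSpace ℝ (Fin d))
    (ω : ℕ → Finset (Fin n)) (k : ℕ) :
    zsState f η lam b x0 ω (k + 1)
      = zsStep f (η k) (lam k) (b k) (zsState f η lam b x0 ω k) (ω k) := rfl

theorem zsState_congr {d n : ℕ} (f : Fin n → EuclideanSpace ℝ (Fin d) → ℝ)
    (η lam : ℕ → ℝ) (b : ℕ → ℕ) (x0 : EuclideanSpace ℝ (Fin d))
    (ω ω' : ℕ → Finset (Fin n)) (k : ℕ) (h : ∀ j < k, ω j = ω' j) :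
    zsState f η lam b x0 ω k = zsState f η lam b x0 ω' k := by
  induction k with
  | zero => rfl
  | succ k ih =>
    rw [zsState_succ, zsState_succ, ih (fun j hj => h j (by omega)), h k (by omega)]

theorem zsExp_state_succ {d n : ℕ} (f : Fin n → EuclideanSpace ℝ (Fin d) → ℝ)
    (η lam : ℕ → ℝ) (b : ℕ → ℕ) (x0 : EuclideanSpace ℝ (Fin d)) (k : ℕ)
    (φ : ZSt d n → ℝ) :
    zsExpK b (k + 1) (fun ω => φ (zsState f η lam b x0 ω (k + 1)))
      = zsExpK b k (fun ω => zsAvg (b k) (fun I =>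
          φ (zsStep f (η k) (lam k) (b k) (zsState f η lam b x0 ω k) I))) := by
  rw [zsExpK_succ]
  congr 1
  funext ω
  congr 1
  funext I
  rw [zsState_succ, Function.update_self,
    zsState_congr f η lam b x0 (Function.update ω k I) ω k
      (fun j hj => Function.update_of_ne (by omega) _ _)]

theorem zs_hasGradient_avg {d n : ℕ} (f : Fin n → EuclideanSpace ℝ (Fin d) → ℝ)
    (hdiff : ∀ i, Differentiable ℝ (f i)) (x : EuclideanSpace ℝ (Fin d)) :
    HasGradientAt (avgF f) ((n : ℝ)⁻¹ • ∑ i, gradient (f i) x) x := by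
  rw [hasGradientAt_iff_hasFDerivAt, map_smul, map_sum]
  unfold avgF
  refine HasFDerivAt.const_mul ?_ _
  exact HasFDerivAt.fun_sum fun i _ => (hdiff i x).hasGradientAt.hasFDerivAt

theorem zs_avg_smooth {d n : ℕ} (hn : 1 ≤ n) (f : Fin n → EuclideanSpace ℝ (Fin d) → ℝ)
    (hdiff : ∀ i, Differentiable ℝ (f i)) (L : ℝ)
    (hsmooth : ∀ i (x y : EuclideanSpace ℝ (Fin d)),
      ‖gradient (f i) x - gradient (f i) y‖ ≤ L * ‖x - y‖) (x y : EuclideanSpace ℝ (Fin d)) :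
    ‖gradient (avgF f) x - gradient (avgF f) y‖ ≤ L * ‖x - y‖ := by
  have hn0 : (0 : ℝ) < n := by exact_mod_cast hn
  rw [(zs_hasGradient_avg f hdiff x).gradient, (zs_hasGradient_avg f hdiff y).gradient,
    ← smul_sub, ← Finset.sum_sub_distrib, norm_smul, Real.norm_eq_abs,
    abs_of_pos (inv_pos.2 hn0)]
  have h1 : ‖∑ i, (gradient (f i) x - gradient (f i) y)‖ ≤ ∑ _i : Fin n, L * ‖x - y‖ :=
    norm_sum_le_of_le _ fun i _ => hsmooth i x y
  rw [Finset.sum_const, Finset.card_univ, Fintype.card_fin, nsmul_eq_mul] at h1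
  calc (n : ℝ)⁻¹ * ‖∑ i, (gradient (f i) x - gradient (f i) y)‖
      ≤ (n : ℝ)⁻¹ * (n * (L * ‖x - y‖)) := by gcongr
    _ = L * ‖x - y‖ := by field_simp

/-- Squared estimator error. -/
def zsVar {d n : ℕ} (f : Fin n → EuclideanSpace ℝ (Fin d) → ℝ) (s : ZSt d n) : ℝ :=
  ‖s.2.2.1 - gradient (avgF f) s.2.1‖ ^ 2

/-- Mean squared table error. -/
def zsTab {d n : ℕ} (f : Fin n → EuclideanSpace ℝ (Fin d) → ℝ) (s : ZSt d n) : ℝ :=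
  (n : ℝ)⁻¹ * ∑ i, ‖gradient (f i) s.2.1 - s.2.2.2 i‖ ^ 2

/-- Squared displacement. -/
def zsDis {d n : ℕ} (s : ZSt d n) : ℝ := ‖s.1 - s.2.1‖ ^ 2

/-- The potential function. -/
def zsPot {d n : ℕ} (f : Fin n → EuclideanSpace ℝ (Fin d) → ℝ) (η L : ℝ) (r : ℕ)
    (s : ZSt d n) : ℝ :=
  avgF f s.1 + (η * r - η / 2) * zsVar f s + η / r * zsTab f s
    + (1 / (2 * η) - L / 2) * zsDis s

section
variable {d n r : ℕ} (f : Fin n → EuclideanSpace ℝ (Fin d) → ℝ) (L η lam : ℝ)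

theorem zsPot_step_det (hn : 1 ≤ n) (hη : 0 < η)
    (hdiff : ∀ i, Differentiable ℝ (f i))
    (hsmooth : ∀ i (x y : EuclideanSpace ℝ (Fin d)),
      ‖gradient (f i) x - gradient (f i) y‖ ≤ L * ‖x - y‖) (s : ZSt d n)
    (I : Finset (Fin n)) :
    zsPot f η L r (zsStep f η lam r s I)
      ≤ (avgF f s.1 - η / 2 * ‖gradient (avgF f) s.1‖ ^ 2)
        + (η * r * zsVar f (zsStep f η lam r s I) + η / r * zsTab f (zsStep f η lam r s I)) := by
  have hd : Differentiable ℝ (avgF f) := fun x =>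
    (zs_hasGradient_avg f hdiff x).differentiableAt
  have h := zs_descent (avgF f) hd L (zs_avg_smooth hn f hdiff L hsmooth) s.1
    (s.1 - η • zsV f lam r s I)
  unfold zsPot
  have hD : zsDis (zsStep f η lam r s I) = η ^ 2 * ‖zsV f lam r s I‖ ^ 2 := by
    simp only [zsDis, zsStep]
    rw [sub_sub_cancel_left, norm_neg, norm_smul, mul_pow, Real.norm_eq_abs, sq_abs]
  have hV : zsVar f (zsStep f η lam r s I) = ‖zsV f lam r s I‖ ^ 2
      - 2 * inner ℝ (gradient (avgF f) s.1) (zsV f lam r s I)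
      + ‖gradient (avgF f) s.1‖ ^ 2 := by
    simp only [zsVar, zsStep]
    rw [norm_sub_sq_real, real_inner_comm]
  have hx : (zsStep f η lam r s I).1 = s.1 - η • zsV f lam r s I := rfl
  rw [sub_sub_cancel_left, inner_neg_right, inner_smul_right, norm_neg, norm_smul, mul_pow,
    Real.norm_eq_abs, sq_abs] at h
  rw [hx, hD]
  have e : (1 / (2 * η) - L / 2) * (η ^ 2 * ‖zsV f lam r s I‖ ^ 2)
      = η / 2 * ‖zsV f lam r s I‖ ^ 2 - L / 2 * (η ^ 2 * ‖zsV f lam r s I‖ ^ 2) := by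
    field_simp
  rw [e]
  have e2 : η / 2 * zsVar f (zsStep f η lam r s I) = η / 2 * (‖zsV f lam r s I‖ ^ 2
      - 2 * inner ℝ (gradient (avgF f) s.1) (zsV f lam r s I)
      + ‖gradient (avgF f) s.1‖ ^ 2) := by rw [hV]
  linarith

theorem zsVar_step (hr : 2 ≤ r) (hn : n = r ^ 2)
    (hdiff : ∀ i, Differentiable ℝ (f i))
    (hsmooth : ∀ i (x y : EuclideanSpace ℝ (Fin d)),
      ‖gradient (f i) x - gradient (f i) y‖ ≤ L * ‖x - y‖) (s : ZSt d n) :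
    zsAvg r (fun I => zsVar f (zsStep f η lam r s I))
      ≤ (1 - lam) ^ 2 * zsVar f s
        + (r : ℝ)⁻¹ * (2 * (L ^ 2 * zsDis s) + 2 * lam ^ 2 * zsTab f s) := by
  have hrn : r ≤ n := by nlinarith
  have hq : ∀ i, ‖gradient (f i) s.1 - gradient (f i) s.2.1‖ ^ 2 ≤ L ^ 2 * zsDis s := by
    intro i
    rw [zsDis, ← mul_pow]
    gcongr
    exact hsmooth i _ _
  have h := zs_V_step hr hrn (fun i => gradient (f i) s.1) (fun i => gradient (f i) s.2.1)
    s.2.2.2 s.2.2.1 lam _ hq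
  simp only [← (zs_hasGradient_avg f hdiff _).gradient] at h
  exact h

theorem zsTab_step (hr : 2 ≤ r) (hn : n = r ^ 2)
    (hsmooth : ∀ i (x y : EuclideanSpace ℝ (Fin d)),
      ‖gradient (f i) x - gradient (f i) y‖ ≤ L * ‖x - y‖) (s : ZSt d n) :
    zsAvg r (fun I => zsTab f (zsStep f η lam r s I))
      ≤ (1 - 1 / (2 * r)) * zsTab f s + 2 * r * (L ^ 2 * zsDis s) := by
  have hq : ∀ i, ‖gradient (f i) s.1 - gradient (f i) s.2.1‖ ^ 2 ≤ L ^ 2 * zsDis s := by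
    intro i
    rw [zsDis, ← mul_pow]
    gcongr
    exact hsmooth i _ _
  exact zs_H_step hr hn (fun i => gradient (f i) s.1) (fun i => gradient (f i) s.2.1)
    s.2.2.2 _ hq (by unfold zsDis; positivity)

theorem zsPot_step (hr : 2 ≤ r) (hn : n = r ^ 2) (hη : 0 < η)
    (hdiff : ∀ i, Differentiable ℝ (f i))
    (hsmooth : ∀ i (x y : EuclideanSpace ℝ (Fin d)),
      ‖gradient (f i) x - gradient (f i) y‖ ≤ L * ‖x - y‖) (s : ZSt d n) :
    zsAvg r (fun I => zsPot f η L r (zsStep f η lam r s I))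
      ≤ (avgF f s.1 - η / 2 * ‖gradient (avgF f) s.1‖ ^ 2)
        + (η * r * ((1 - lam) ^ 2 * zsVar f s
            + (r : ℝ)⁻¹ * (2 * (L ^ 2 * zsDis s) + 2 * lam ^ 2 * zsTab f s))
          + η / r * ((1 - 1 / (2 * r)) * zsTab f s + 2 * r * (L ^ 2 * zsDis s))) := by
  have hrn : r ≤ n := by nlinarith
  refine (zsAvg_mono _ _ fun I _ =>
    zsPot_step_det (r := r) f L η lam (by omega) hη hdiff hsmooth s I).trans ?_
  rw [zsAvg_add, zsAvg_const hrn, zsAvg_add, zsAvg_mul, zsAvg_mul]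
  have h1 := zsVar_step f L η lam hr hn hdiff hsmooth s
  have h2 := zsTab_step f L η lam hr hn hsmooth s
  gcongr

theorem zsPot_step_later (hr : 2 ≤ r) (hn : n = r ^ 2) (hη : 0 < η)
    (hηL : 8 * L ^ 2 * η ^ 2 ≤ 1 - L * η) (hlam : lam = 1 / (2 * r))
    (hdiff : ∀ i, Differentiable ℝ (f i))
    (hsmooth : ∀ i (x y : EuclideanSpace ℝ (Fin d)),
      ‖gradient (f i) x - gradient (f i) y‖ ≤ L * ‖x - y‖) (s : ZSt d n) :
    zsAvg r (fun I => zsPot f η L r (zsStep f η lam r s I))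
      ≤ zsPot f η L r s - η / 2 * ‖gradient (avgF f) s.1‖ ^ 2 := by
  refine (zsPot_step f L η lam hr hn hη hdiff hsmooth s).trans ?_
  have hr1 : (1 : ℝ) ≤ r := by exact_mod_cast (by omega : 1 ≤ r)
  have hr0 : (0 : ℝ) < r := by linarith
  have hV0 : 0 ≤ zsVar f s := by unfold zsVar; positivity
  have hD0 : 0 ≤ zsDis s := by unfold zsDis; positivity
  unfold zsPot
  generalize zsVar f s = v at *
  generalize zsDis s = D at *
  generalize zsTab f s = T at *
  have key : (avgF f s.1 + (η * r - η / 2) * v + η / r * T + (1 / (2 * η) - L / 2) * D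
      - η / 2 * ‖gradient (avgF f) s.1‖ ^ 2) -
      ((avgF f s.1 - η / 2 * ‖gradient (avgF f) s.1‖ ^ 2)
        + (η * r * ((1 - lam) ^ 2 * v + (r : ℝ)⁻¹ * (2 * (L ^ 2 * D) + 2 * lam ^ 2 * T))
          + η / r * ((1 - 1 / (2 * r)) * T + 2 * r * (L ^ 2 * D))))
      = η / 2 * (1 - lam) * v + (1 - L * η - 8 * L ^ 2 * η ^ 2) / (2 * η) * D := by
    rw [hlam]
    field_simp
    ring
  have hl : 0 ≤ 1 - lam := by
    rw [hlam, sub_nonneg, div_le_one (by positivity)]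
    linarith
  have h1 : 0 ≤ η / 2 * (1 - lam) * v := by positivity
  have h2 : 0 ≤ (1 - L * η - 8 * L ^ 2 * η ^ 2) / (2 * η) * D := by
    have : 0 ≤ 1 - L * η - 8 * L ^ 2 * η ^ 2 := by linarith
    positivity
  linarith

theorem zsPot_step_first (hr : 2 ≤ r) (hn : n = r ^ 2) (hη : 0 < η) (hlam : lam = 1)
    (hdiff : ∀ i, Differentiable ℝ (f i))
    (hsmooth : ∀ i (x y : EuclideanSpace ℝ (Fin d)),
      ‖gradient (f i) x - gradient (f i) y‖ ≤ L * ‖x - y‖) (x0 : EuclideanSpace ℝ (Fin d)) :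
    zsAvg r (fun I => zsPot f η L r (zsStep f η lam r (x0, x0, 0, fun _ => 0) I))
      ≤ avgF f x0 - η / 2 * ‖gradient (avgF f) x0‖ ^ 2
        + 3 * η * ((n : ℝ)⁻¹ * ∑ i, ‖gradient (f i) x0‖ ^ 2) := by
  refine (zsPot_step f L η lam hr hn hη hdiff hsmooth _).trans ?_
  have hr1 : (1 : ℝ) ≤ r := by exact_mod_cast (by omega : 1 ≤ r)
  have hr0 : (0 : ℝ) < r := by linarith
  have hD : zsDis ((x0, x0, 0, fun _ => 0) : ZSt d n) = 0 := by simp [zsDis]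
  have hT : zsTab f ((x0, x0, 0, fun _ => 0) : ZSt d n)
      = (n : ℝ)⁻¹ * ∑ i, ‖gradient (f i) x0‖ ^ 2 := by simp [zsTab]
  rw [hD, hT, hlam]
  clear hD hT
  have hG : 0 ≤ (n : ℝ)⁻¹ * ∑ i, ‖gradient (f i) x0‖ ^ 2 :=
    mul_nonneg (inv_nonneg.2 (Nat.cast_nonneg n)) (Finset.sum_nonneg fun i _ => sq_nonneg _)
  generalize (n : ℝ)⁻¹ * ∑ i, ‖gradient (f i) x0‖ ^ 2 = G at hG ⊢
  generalize zsVar f ((x0, x0, 0, fun _ => 0) : ZSt d n) = W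
  have e : 3 * η * G - (η * r * ((1 - 1) ^ 2 * W
            + (r : ℝ)⁻¹ * (2 * (L ^ 2 * 0) + 2 * 1 ^ 2 * G))
          + η / r * ((1 - 1 / (2 * r)) * G + 2 * r * (L ^ 2 * 0)))
      = η * G * ((r - 1) / r + 1 / (2 * r ^ 2)) := by
    field_simp
    ring
  have h : 0 ≤ η * G * ((r - 1) / r + 1 / (2 * (r : ℝ) ^ 2)) := by
    have : (0 : ℝ) ≤ r - 1 := by linarith
    positivity
  simp only
  linarith

end

theorem zs_eta {L : ℝ} (hL : 0 < L) :
    8 * L ^ 2 * (1 / ((1 + Real.sqrt 8) * L)) ^ 2 ≤ 1 - L * (1 / ((1 + Real.sqrt 8) * L)) := by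
  have h8 : Real.sqrt 8 ^ 2 = 8 := Real.sq_sqrt (by norm_num)
  have h0 : 0 ≤ Real.sqrt 8 := Real.sqrt_nonneg 8
  set q := Real.sqrt 8
  have e : 1 - L * (1 / ((1 + q) * L)) - 8 * L ^ 2 * (1 / ((1 + q) * L)) ^ 2
      = (q * (1 + q) - 8) / (1 + q) ^ 2 := by
    field_simp
    ring
  have : 0 ≤ (q * (1 + q) - 8) / (1 + q) ^ 2 := by
    apply div_nonneg _ (by positivity)
    nlinarith
  linarith

/-- The main sum bound. -/
theorem zs_main {d n r : ℕ} (hn : 2 ≤ n)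
    (hr : n = r ^ 2)
    (L : ℝ) (hL : 0 < L)
    (f : Fin n → EuclideanSpace ℝ (Fin d) → ℝ)
    (hdiff : ∀ i, Differentiable ℝ (f i))
    (hsmooth : ∀ i (x y : EuclideanSpace ℝ (Fin d)),
      ‖gradient (f i) x - gradient (f i) y‖ ≤ L * ‖x - y‖)
    (x0 : EuclideanSpace ℝ (Fin d))
    (fstar : ℝ) (hfstar : IsGLB (Set.range (avgF f)) fstar)
    (η lam : ℕ → ℝ) (b : ℕ → ℕ)
    (hη : ∀ k, η k = 1 / ((1 + Real.sqrt 8) * L))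
    (hbk : ∀ k, b k = r)
    (hlam0 : lam 0 = 1) (hlamk : ∀ k, 1 ≤ k → lam k = 1 / (2 * (r : ℝ)))
    (K : ℕ) (hK : 1 ≤ K) :
    ∑ k ∈ Finset.range K,
          zsExpK b k (fun ω => ‖gradient (avgF f) ((zsState f η lam b x0 ω k).1)‖ ^ 2)
        ≤ 2 * (1 + Real.sqrt 8) * L * (avgF f x0 - fstar)
            + 6 * ((n : ℝ)⁻¹ * ∑ i, ‖gradient (f i) x0‖ ^ 2) := by
  have hr2 : 2 ≤ r := by
    by_contra h
    have : r ≤ 1 := by omega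
    nlinarith
  have hrn : r ≤ n := by nlinarith
  have hr1 : (1 : ℝ) ≤ r := by exact_mod_cast (by omega : 1 ≤ r)
  have hq0 : 0 ≤ Real.sqrt 8 := Real.sqrt_nonneg 8
  set e : ℝ := 1 / ((1 + Real.sqrt 8) * L) with he
  have he0 : 0 < e := by positivity
  have heL : 8 * L ^ 2 * e ^ 2 ≤ 1 - L * e := zs_eta hL
  set N : ℕ → ℝ := fun k =>
    zsExpK b k (fun ω => ‖gradient (avgF f) ((zsState f η lam b x0 ω k).1)‖ ^ 2) with hN
  set G : ℝ := (n : ℝ)⁻¹ * ∑ i, ‖gradient (f i) x0‖ ^ 2 with hG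
  set M : ℕ → ℝ := fun k => zsExpK b k (fun ω => zsPot f e L r (zsState f η lam b x0 ω k))
    with hM
  have hstep : ∀ k, 1 ≤ k → M (k + 1) ≤ M k - e / 2 * N k := by
    intro k hk
    simp only [hM, hN]
    rw [zsExp_state_succ f η lam b x0 k (zsPot f e L r), ← zsExpK_sub_mul]
    apply zsExpK_mono
    intro ω
    rw [hbk, hη]
    exact zsPot_step_later f L e (lam k) hr2 hr he0 heL (hlamk k hk) hdiff hsmooth _
  have hfirst : M 1 ≤ avgF f x0 - e / 2 * N 0 + 3 * e * G := by
    simp only [hM, hN]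
    rw [zsExp_state_succ f η lam b x0 0 (zsPot f e L r), zsExpK_zero, zsExpK_zero, hbk, hη]
    exact zsPot_step_first f L e (lam 0) hr2 hr he0 hlam0 hdiff hsmooth x0
  have hsum : ∀ K, 1 ≤ K →
      M K + e / 2 * ∑ k ∈ Finset.range K, N k ≤ avgF f x0 + 3 * e * G := by
    intro K hK
    induction K, hK using Nat.le_induction with
    | base =>
      rw [Finset.sum_range_one]
      linarith
    | succ k hk ih =>
      rw [Finset.sum_range_succ]
      have := hstep k hk
      linarith
  have hlow : fstar ≤ M K := by
    have h1 : zsExpK (n := n) b K (fun _ => fstar) = fstar :=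
      zsExpK_const b (fun k => by rw [hbk]; exact hrn) K fstar
    rw [← h1]
    apply zsExpK_mono
    intro ω
    generalize zsState f η lam b x0 ω K = s
    have h2 : fstar ≤ avgF f s.1 := hfstar.1 ⟨s.1, rfl⟩
    unfold zsPot
    have h3 : 0 ≤ (e * r - e / 2) * zsVar f s := by
      apply mul_nonneg
      · nlinarith
      · unfold zsVar; positivity
    have h4 : 0 ≤ e / r * zsTab f s := by
      unfold zsTab
      positivity
    have h5 : 0 ≤ (1 / (2 * e) - L / 2) * zsDis s := by
      apply mul_nonneg
      · have : 1 / (2 * e) - L / 2 = (1 - L * e) / (2 * e) := by field_simp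
        rw [this]
        apply div_nonneg _ (by positivity)
        nlinarith [sq_nonneg (L * e)]
      · unfold zsDis; positivity
    linarith
  have hfin := hsum K hK
  have h6 : e / 2 * ∑ k ∈ Finset.range K, N k ≤ avgF f x0 - fstar + 3 * e * G := by linarith
  have h7 : 2 * (1 + Real.sqrt 8) * L * (avgF f x0 - fstar) + 6 * G
      = (avgF f x0 - fstar + 3 * e * G) * (2 / e) := by
    rw [he]
    field_simp
    ring
  rw [h7]
  calc ∑ k ∈ Finset.range K, N k = (e / 2 * ∑ k ∈ Finset.range K, N k) * (2 / e) := by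
        field_simp
    _ ≤ _ := by gcongr

/-- Corollary 2 (ZeroSARAH with no full gradient computations: `bₖ = √n` for all `k`,
`λ₀ = 1`, `λₖ = 1/(2√n)`, constant stepsize `η = 1/((1+√8)L)`);
here `G₀ = (1/n)∑ᵢ‖∇fᵢ(x⁰)‖²`. -/
theorem zerosarah_corollary2 {d n r : ℕ} (hd : 1 ≤ d) (hn : 2 ≤ n)
    (hr : n = r ^ 2)
    (L : ℝ) (hL : 0 < L)
    (f : Fin n → EuclideanSpace ℝ (Fin d) → ℝ)
    (hdiff : ∀ i, Differentiable ℝ (f i))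
    (hsmooth : ∀ i (x y : EuclideanSpace ℝ (Fin d)),
      ‖gradient (f i) x - gradient (f i) y‖ ≤ L * ‖x - y‖)
    (x0 : EuclideanSpace ℝ (Fin d))
    (fstar : ℝ) (hfstar : IsGLB (Set.range (avgF f)) fstar)
    (η lam : ℕ → ℝ) (b : ℕ → ℕ)
    (hη : ∀ k, η k = 1 / ((1 + Real.sqrt 8) * L))
    (hbk : ∀ k, b k = r)
    (hlam0 : lam 0 = 1) (hlamk : ∀ k, 1 ≤ k → lam k = 1 / (2 * (r : ℝ))) :
    (∀ K : ℕ, 1 ≤ K →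
      (K : ℝ)⁻¹ * ∑ k ∈ Finset.range K,
          zsExpK b k (fun ω => ‖gradient (avgF f) ((zsState f η lam b x0 ω k).1)‖ ^ 2)
        ≤ (2 * (1 + Real.sqrt 8) * L * (avgF f x0 - fstar)
            + 6 * ((n : ℝ)⁻¹ * ∑ i, ‖gradient (f i) x0‖ ^ 2)) / (K : ℝ))
    ∧ (∀ ε : ℝ, 0 < ε → ∀ K : ℕ,
        K = ⌈(2 * (1 + Real.sqrt 8) * L * (avgF f x0 - fstar)
            + 6 * ((n : ℝ)⁻¹ * ∑ i, ‖gradient (f i) x0‖ ^ 2)) / ε ^ 2⌉₊ →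
        (K : ℝ)⁻¹ * ∑ k ∈ Finset.range K,
            zsExpK b k (fun ω => ‖gradient (avgF f) ((zsState f η lam b x0 ω k).1)‖ ^ 2)
          ≤ ε ^ 2
        ∧ (r : ℝ) * (K : ℝ)
          ≤ (r : ℝ) * (2 * (1 + Real.sqrt 8) * L * (avgF f x0 - fstar)
              + 6 * ((n : ℝ)⁻¹ * ∑ i, ‖gradient (f i) x0‖ ^ 2)) / ε ^ 2 + (r : ℝ))
    ∧ (∀ fs : Fin n → ℝ, (∀ i, IsGLB (Set.range (f i)) (fs i)) →
        (n : ℝ)⁻¹ * ∑ i, ‖gradient (f i) x0‖ ^ 2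
          ≤ 2 * L * (avgF f x0 - (n : ℝ)⁻¹ * ∑ i, fs i)) := by
  have hmain := zs_main hn hr L hL f hdiff hsmooth x0 fstar hfstar η lam b hη hbk hlam0 hlamk
  have hn0 : (0 : ℝ) < n := by exact_mod_cast (by omega : 0 < n)
  have hf0 : fstar ≤ avgF f x0 := hfstar.1 ⟨x0, rfl⟩
  have hQ : 0 ≤ 2 * (1 + Real.sqrt 8) * L * (avgF f x0 - fstar)
            + 6 * ((n : ℝ)⁻¹ * ∑ i, ‖gradient (f i) x0‖ ^ 2) := by
    have : 0 ≤ avgF f x0 - fstar := by linarith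
    positivity
  refine ⟨?_, ?_, ?_⟩
  · intro K hK
    have hK0 : (0 : ℝ) < K := by exact_mod_cast hK
    rw [inv_mul_eq_div]
    gcongr
    exact hmain K hK
  · intro ε hε K hK
    set Q := 2 * (1 + Real.sqrt 8) * L * (avgF f x0 - fstar)
            + 6 * ((n : ℝ)⁻¹ * ∑ i, ‖gradient (f i) x0‖ ^ 2) with hQdef
    have hε2 : 0 < ε ^ 2 := by positivity
    constructor
    · rcases Nat.eq_zero_or_pos K with h0 | h0
      · subst h0
        simp
        positivity
      · have hK0 : (0 : ℝ) < K := by exact_mod_cast h0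
        have h1 : Q / ε ^ 2 ≤ K := by
          rw [hK]
          exact Nat.le_ceil _
        rw [div_le_iff₀ hε2] at h1
        rw [inv_mul_eq_div, div_le_iff₀ hK0]
        have := hmain K h0
        linarith
    · have h1 : (K : ℝ) < Q / ε ^ 2 + 1 := by
        rw [hK]
        exact Nat.ceil_lt_add_one (by positivity)
      calc (r : ℝ) * K ≤ r * (Q / ε ^ 2 + 1) := by gcongr
        _ = r * Q / ε ^ 2 + r := by ring
  · intro fs hfs
    have h1 : ∑ i, ‖gradient (f i) x0‖ ^ 2 ≤ ∑ i, 2 * L * (f i x0 - fs i) :=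
      Finset.sum_le_sum fun i _ => zs_grad_bound (f i) (hdiff i) L hL (hsmooth i) x0 (fs i)
        (fun y => (hfs i).1 ⟨y, rfl⟩)
    rw [← Finset.mul_sum, Finset.sum_sub_distrib] at h1
    calc (n : ℝ)⁻¹ * ∑ i, ‖gradient (f i) x0‖ ^ 2
        ≤ (n : ℝ)⁻¹ * (2 * L * (∑ i, f i x0 - ∑ i, fs i)) := by gcongr
      _ = _ := by
        unfold avgF
        ring
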